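/- For every integer n ≥ 1, there exist integers k and ℓ with 2 ≤ k < ℓ ≤ n+2 such that the sequence j ↦ db(n,j) is monotone nondecreasing for 2 ≤ j ≤ k, monotone nonincreasing for k ≤ j ≤ ℓ, and monotone nondecreasing for j ≥ ℓ. -/

import Mathlib

open scoped Classical

/-- A deal of size `n` is a fixed-point-free involution of `Fin (2*n)`. -/
def IsDeal (n : ℕ) (π : Fin (2*n) → Fin (2*n)) : Prop :=
  ∀ j, π (π j) = j ∧ π j ≠ j

/-- The finite set `D_n` of all deals of size `n`. -/
noncomputable def deals (n : ℕ) : Finset (Fin (2*n) → Fin (2*n)) :=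
  Finset.univ.filter (IsDeal n)

/-- The second occurrences of `π` (positions `j` with `π j < j`), in
increasing order: `j_1 < j_2 < ... < j_n`. -/
def blockEnds {n : ℕ} (π : Fin (2*n) → Fin (2*n)) : List (Fin (2*n)) :=
  (Finset.univ.filter (fun j => π j < j)).sort (· ≤ ·)

/-- The block lengths `b_1, ..., b_n` of a deal:
`b_1 = j_1 + 1` and `b_i = j_i - j_(i-1)` for `i ≥ 2`. -/
def blockLens {n : ℕ} (π : Fin (2*n) → Fin (2*n)) : List ℕ :=
  List.zipWith (fun x y => x - y)
    ((blockEnds π).map (fun j => (j : ℕ) + 1))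
    (0 :: (blockEnds π).map (fun j => (j : ℕ) + 1))

/-- The blocks of a deal: each block length `b_i` paired with the ending
position `j_i` of the block. -/
def blocks {n : ℕ} (π : Fin (2*n) → Fin (2*n)) : List (ℕ × Fin (2*n)) :=
  List.zip (blockLens π) (blockEnds π)

/-- The `i`-th block (ending at position `j_i`) is lucky if `π j_i = j_i - 1`. -/
def IsLuckyEnd {n : ℕ} (π : Fin (2*n) → Fin (2*n)) (j : Fin (2*n)) : Prop :=
  (π j).val = (j : ℕ) - 1

/-- `b(n,j)`: total number of blocks of length `j` over all deals in `D_n`. -/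
noncomputable def bcount (n j : ℕ) : ℕ :=
  ∑ π ∈ deals n, (blockLens π).count j

/-- `l(n,j)`: total number of lucky blocks of length `j` over all deals in `D_n`. -/
noncomputable def lcount (n j : ℕ) : ℕ :=
  ∑ π ∈ deals n, (blocks π).countP (fun p => decide (p.1 = j ∧ IsLuckyEnd π p.2))

/-- `eb(n,j)`: the expected number of blocks of length `j` in a random deal. -/
noncomputable def eb (n j : ℕ) : ℝ := (bcount n j : ℝ) / ((deals n).card : ℝ)

/-- `el(n,j)`: the expected number of lucky blocks of length `j` in a random deal. -/
noncomputable def el (n j : ℕ) : ℝ := (lcount n j : ℝ) / ((deals n).card : ℝ)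

/-- `db(n,j) = eb(n,j) - 2(2n+1)/(j(j+1)(j+2))`. -/
noncomputable def db (n j : ℕ) : ℝ :=
  eb n j - 2*(2*(n:ℝ)+1) / ((j:ℝ) * ((j:ℝ)+1) * ((j:ℝ)+2))

/-- `dl(n,j) = el(n,j) - 1/(j(j-1))`. -/
noncomputable def dl (n j : ℕ) : ℝ :=
  el n j - 1 / ((j:ℝ) * ((j:ℝ)-1))

/-- `e(π)`: the number of blocks of `π` of even length. -/
noncomputable def evenBlocks {n : ℕ} (π : Fin (2*n) → Fin (2*n)) : ℕ :=
  (blockLens π).countP (fun b => decide (Even b))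

/-- `l(π)`: the number of even-length lucky blocks of `π`. -/
noncomputable def luckyEvenBlocks {n : ℕ} (π : Fin (2*n) → Fin (2*n)) : ℕ :=
  (blocks π).countP (fun p => decide (Even p.1 ∧ IsLuckyEnd π p.2))


theorem count_eq_sum_sub (j : ℕ) (l : List ℕ) :
    l.count (j + 1) + 2 * (l.map (· - (j + 1))).sum =
      (l.map (· - j)).sum + (l.map (· - (j + 2))).sum := by
  induction l with
  | nil => simp
  | cons b l ih =>
    simp only [List.count_cons, List.map_cons, List.sum_cons, beq_iff_eq]
    split_ifs <;> omega

theorem sum_gaps_sub (m M : ℕ) (l : List ℕ) (p : ℕ) (hl : (p :: l).Pairwise (· < ·))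
    (hM : ∀ y ∈ l, y ≤ M) :
    ((List.zipWith (fun x y => x - y) l (p :: l)).map (· - m)).sum =
      ((Finset.range M).filter fun s =>
        p ≤ s ∧ (∃ y ∈ l, s + m < y) ∧ ∀ y ∈ l, s < y → s + m < y).card := by
  induction l generalizing p with
  | nil => simp
  | cons x l ih =>
    have hpx : p < x := (List.pairwise_cons.1 hl).1 x (by simp)
    have hl' := (List.pairwise_cons.1 hl).2
    have hx := (List.pairwise_cons.1 hl').1
    have hxM : x ≤ M := hM x (by simp)
    have ih' := ih x hl' fun y hy => hM y (by simp [hy])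
    simp only [List.zipWith_cons_cons, List.map_cons, List.sum_cons]
    rw [ih']
    have hcard : x - p - m = (Finset.Ico p (x - m)).card := by simp; omega
    rw [hcard, ← Finset.card_union_of_disjoint]
    · congr 1
      ext s
      simp only [Finset.mem_union, Finset.mem_Ico, Finset.mem_filter, Finset.mem_range,
        List.mem_cons, exists_eq_or_imp, forall_eq_or_imp]
      constructor
      · rintro (h | ⟨h1, h2, h3, h4⟩)
        · refine ⟨by omega, by omega, Or.inl (by omega), fun _ => by omega, fun y hy _ => ?_⟩
          have := hx y hy
          omega
        · exact ⟨h1, by omega, Or.inr h3, fun _ => by omega, h4⟩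
      · rintro ⟨h1, h2, h3, h4, h5⟩
        by_cases hs : s < x
        · left; have := h4 hs; omega
        · right
          refine ⟨h1, by omega, ?_, h5⟩
          rcases h3 with h3 | h3
          · omega
          · exact h3
    · rw [Finset.disjoint_left]
      intro s
      simp only [Finset.mem_Ico, Finset.mem_filter]
      omega

/-- The fixed-point-free involutions of `A`, extended by the identity, that map `W` into `R`. -/
noncomputable def pairings {γ : Type*} [Fintype γ] (A W R : Finset γ) : Finset (γ → γ) :=
  Finset.univ.filter fun f =>
    (∀ x, f (f x) = x) ∧ (∀ x, f x = x ↔ x ∉ A) ∧ ∀ w ∈ W, f w ∈ R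

theorem card_pairings_filter {γ : Type*} [Fintype γ] {A W R : Finset γ} (hW : W ⊆ A) (hR : R ⊆ A)
    (h : Disjoint W R) {w r : γ} (hw : w ∈ W) (hr : r ∈ R) :
    ((pairings A W R).filter fun f => f w = r).card =
      (pairings ((A.erase w).erase r) (W.erase w) (R.erase r)).card := by
  have hwr : w ≠ r := fun e => Finset.disjoint_left.1 h hw (e ▸ hr)
  have hwR : w ∉ R := Finset.disjoint_left.1 h hw
  have hrW : r ∉ W := Finset.disjoint_right.1 h hr
  have hwA := hW hw
  have hrA := hR hr
  refine Finset.card_bij' (fun f _ x => Equiv.swap w r (f x)) (fun f _ x => Equiv.swap w r (f x))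
    ?_ ?_ ?_ ?_
  · intro f hf
    simp only [pairings, Finset.mem_filter, Finset.mem_univ, true_and, Finset.mem_erase] at hf ⊢
    obtain ⟨⟨h1, h2, h3⟩, h4⟩ := hf
    have h5 : f r = w := by rw [← h4, h1]
    have key : ∀ x, x ≠ w → x ≠ r → Equiv.swap w r (f x) = f x := fun x hxw hxr =>
      Equiv.swap_apply_of_ne_of_ne (fun e => hxr (by rw [← h1 x, e, h4]))
        (fun e => hxw (by rw [← h1 x, e, h5]))
    have kw : Equiv.swap w r (f w) = w := by simp [h4]
    have kr : Equiv.swap w r (f r) = r := by simp [h5]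
    refine ⟨fun x => ?_, fun x => ?_, fun x hx => ?_⟩
    · by_cases hxw : x = w
      · rw [hxw, kw, kw]
      by_cases hxr : x = r
      · rw [hxr, kr, kr]
      rw [key x hxw hxr, h1, Equiv.swap_apply_of_ne_of_ne hxw hxr]
    · by_cases hxw : x = w
      · simp [hxw, kw]
      by_cases hxr : x = r
      · simp [hxr, kr]
      simp [key x hxw hxr, h2, hxw, hxr]
    · have hxr : x ≠ r := fun e => hrW (e ▸ hx.2)
      rw [key x hx.1 hxr]
      refine ⟨fun e => hx.1 (by rw [← h1 x, e, h5]), h3 x hx.2⟩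
  · intro f hf
    simp only [pairings, Finset.mem_filter, Finset.mem_univ, true_and, Finset.mem_erase] at hf ⊢
    obtain ⟨h1, h2, h3⟩ := hf
    have h4 : f w = w := by rw [h2]; simp
    have h5 : f r = r := by rw [h2]; simp
    have key : ∀ x, x ≠ w → x ≠ r → Equiv.swap w r (f x) = f x := fun x hxw hxr =>
      Equiv.swap_apply_of_ne_of_ne (fun e => hxw (by rw [← h1 x, e, h4]))
        (fun e => hxr (by rw [← h1 x, e, h5]))
    have kw : Equiv.swap w r (f w) = r := by simp [h4]
    have kr : Equiv.swap w r (f r) = w := by simp [h5]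
    refine ⟨⟨fun x => ?_, fun x => ?_, fun x hx => ?_⟩, kw⟩
    · by_cases hxw : x = w
      · rw [hxw, kw, kr]
      by_cases hxr : x = r
      · rw [hxr, kr, kw]
      rw [key x hxw hxr, h1, Equiv.swap_apply_of_ne_of_ne hxw hxr]
    · by_cases hxw : x = w
      · simp [hxw, kw, hwA, hwr.symm]
      by_cases hxr : x = r
      · simp [hxr, kr, hrA, hwr]
      simp [key x hxw hxr, h2, hxw, hxr]
    · by_cases hxw : x = w
      · rw [hxw, kw]; exact hr
      have hxr : x ≠ r := fun e => hrW (e ▸ hx)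
      rw [key x hxw hxr]
      exact (h3 x ⟨hxw, hx⟩).2
  · intro f _; simp
  · intro f _; simp

theorem card_pairings_eq_sum {γ : Type*} [Fintype γ] {A W R : Finset γ} (hW : W ⊆ A) (hR : R ⊆ A)
    (h : Disjoint W R) {w : γ} (hw : w ∈ W) :
    (pairings A W R).card =
      ∑ r ∈ R, (pairings ((A.erase w).erase r) (W.erase w) (R.erase r)).card := by
  rw [Finset.card_eq_sum_card_fiberwise (f := fun f => f w) (t := R)]
  · exact Finset.sum_congr rfl fun r hr => card_pairings_filter hW hR h hw hr
  · intro f hf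
    simp only [pairings, Finset.coe_filter, Finset.mem_univ, true_and, Set.mem_ofPred_eq] at hf
    exact hf.2.2 w hw

/-- The number of fixed-point-free involutions of a set with `k` elements. -/
def pairingCount : ℕ → ℕ
  | 0 => 1
  | 1 => 0
  | k + 2 => (k + 1) * pairingCount k

theorem card_pairings_empty {γ : Type*} [Fintype γ] (A R : Finset γ) :
    (pairings A ∅ R).card = pairingCount A.card := by
  induction hk : A.card using Nat.strong_induction_on generalizing A R with
  | _ k ih =>
    rcases A.eq_empty_or_nonempty with rfl | ⟨w, hw⟩
    · simp only [Finset.card_empty] at hk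
      subst hk
      rw [pairingCount, Finset.card_eq_one]
      refine ⟨id, ?_⟩
      ext f
      simp only [pairings, Finset.mem_filter, Finset.mem_univ, true_and, Finset.notMem_empty,
        not_false_eq_true, iff_true, Finset.mem_singleton]
      refine ⟨fun h => funext h.2.1, ?_⟩
      rintro rfl
      simp
    · have e : pairings A ∅ R = pairings A {w} (A.erase w) := by
        ext f
        simp only [pairings, Finset.mem_filter, Finset.mem_univ, true_and, Finset.notMem_empty,
          Finset.mem_singleton, forall_eq, Finset.mem_erase]
        refine ⟨fun ⟨h1, h2, _⟩ => ⟨h1, h2, ?_, ?_⟩, fun ⟨h1, h2, _⟩ => ⟨h1, h2, by simp⟩⟩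
        · rw [Ne, h2]; simpa
        · by_contra hA
          have := (h2 _).2 hA
          rw [h1] at this
          exact (h2 w).1 this.symm hw
      rw [e, card_pairings_eq_sum (by simpa) (Finset.erase_subset _ _) (by simp)
        (Finset.mem_singleton_self w)]
      have hc : ∀ r ∈ A.erase w, ((A.erase w).erase r).card = k - 2 := by
        intro r hr
        rw [Finset.card_erase_of_mem hr, Finset.card_erase_of_mem hw]
        omega
      have hk0 : 0 < k := hk ▸ Finset.card_pos.2 ⟨w, hw⟩
      simp only [Finset.erase_singleton]
      rw [Finset.sum_congr rfl fun r hr => ih (k - 2) (by omega) _ _ (hc r hr)]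
      rw [Finset.sum_const, Finset.card_erase_of_mem hw, hk, smul_eq_mul]
      match k, hk0 with
      | 1, _ => simp [pairingCount]
      | k + 2, _ => simp [pairingCount]

theorem card_pairings {γ : Type*} [Fintype γ] {A W R : Finset γ} (hW : W ⊆ A) (hR : R ⊆ A)
    (h : Disjoint W R) :
    (pairings A W R).card = R.card.descFactorial W.card * pairingCount (A.card - 2 * W.card) := by
  induction hm : W.card generalizing A W R with
  | zero =>
    rw [Finset.card_eq_zero] at hm
    subst hm
    simp [card_pairings_empty]
  | succ m ih =>
    obtain ⟨w, hw⟩ : W.Nonempty := Finset.card_pos.1 (by omega)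
    rw [card_pairings_eq_sum hW hR h hw]
    have step : ∀ r ∈ R, (pairings ((A.erase w).erase r) (W.erase w) (R.erase r)).card =
        (R.card - 1).descFactorial m * pairingCount (A.card - 2 * (m + 1)) := by
      intro r hr
      have hwR : w ∉ R := Finset.disjoint_left.1 h hw
      have hrW : r ∉ W := Finset.disjoint_right.1 h hr
      have hrw : r ≠ w := fun e => hwR (e ▸ hr)
      rw [ih, Finset.card_erase_of_mem hr,
        Finset.card_erase_of_mem (Finset.mem_erase.2 ⟨hrw, hR hr⟩),
        Finset.card_erase_of_mem (hW hw)]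
      · congr 2
        omega
      · intro x hx
        have := Finset.mem_erase.1 hx
        exact Finset.mem_erase.2 ⟨fun e => hrW (e ▸ this.2), Finset.mem_erase.2 ⟨this.1, hW this.2⟩⟩
      · intro x hx
        have := Finset.mem_erase.1 hx
        exact Finset.mem_erase.2 ⟨this.1, Finset.mem_erase.2 ⟨fun e => hwR (e ▸ this.2), hR this.2⟩⟩
      · exact h.mono (Finset.erase_subset _ _) (Finset.erase_subset _ _)
      · rw [Finset.card_erase_of_mem hw]; omega
    rw [Finset.sum_congr rfl step, Finset.sum_const, smul_eq_mul, ← mul_assoc]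
    rcases R.card with _ | c
    · simp
    · rw [Nat.succ_descFactorial_succ, Nat.add_sub_cancel]

theorem deals_eq_pairings (n : ℕ) : deals n = pairings Finset.univ ∅ ∅ := by
  ext f
  simp only [deals, IsDeal, pairings, Finset.mem_filter, Finset.mem_univ, true_and, not_true,
    iff_false, Finset.notMem_empty, false_imp_iff, implies_true, and_true, forall_and]

theorem card_deals (n : ℕ) : (deals n).card = pairingCount (2 * n) := by
  rw [deals_eq_pairings, card_pairings_empty, Finset.card_univ, Fintype.card_fin]

theorem blockLens_eq {n : ℕ} (π : Fin (2 * n) → Fin (2 * n)) :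
    blockLens π = List.zipWith (fun x y => x - y)
      ((blockEnds π).map (fun j : Fin (2 * n) => (j : ℕ) + 1))
      (0 :: (blockEnds π).map (fun j : Fin (2 * n) => (j : ℕ) + 1)) := by
  simp [blockLens, ← List.map_eq_flatMap, Function.comp_def]

theorem mem_map_blockEnds {n : ℕ} (π : Fin (2 * n) → Fin (2 * n)) (y : ℕ) :
    y ∈ (blockEnds π).map (fun j : Fin (2 * n) => (j : ℕ) + 1) ↔
      ∃ j : Fin (2 * n), π j < j ∧ (j : ℕ) + 1 = y := by
  simp [blockEnds]

theorem sum_blockLens_sub {n m : ℕ} (hm : 1 ≤ m) {π : Fin (2 * n) → Fin (2 * n)}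
    (hπ : IsDeal n π) :
    ((blockLens π).map (· - m)).sum =
      ((Finset.range (2 * n - m)).filter fun s =>
        ∀ t : Fin (2 * n), s ≤ (t : ℕ) → (t : ℕ) < s + m → t < π t).card := by
  rw [blockLens_eq, sum_gaps_sub m (2 * n)]
  · congr 1
    ext s
    simp only [Finset.mem_filter, Finset.mem_range, mem_map_blockEnds]
    constructor
    · rintro ⟨h1, -, ⟨y, ⟨j, hj, rfl⟩, hy⟩, h4⟩
      have := j.2
      refine ⟨by omega, fun t ht1 ht2 => ?_⟩
      rcases lt_trichotomy t (π t) with h | h | h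
      · exact h
      · exact absurd h.symm (hπ t).2
      · have := h4 _ ⟨t, h, rfl⟩ (by omega)
        omega
    · rintro ⟨h1, h2⟩
      have hlast : π ⟨2 * n - 1, by omega⟩ < ⟨2 * n - 1, by omega⟩ := by
        refine lt_of_le_of_ne ?_ (hπ _).2
        rw [Fin.le_def]
        have := (π ⟨2 * n - 1, by omega⟩).2
        simp only
        omega
      refine ⟨by omega, by omega, ⟨2 * n - 1 + 1, ⟨_, hlast, rfl⟩, by omega⟩, ?_⟩
      rintro y ⟨j, hj, rfl⟩ hy
      by_contra hlt
      exact absurd (h2 j (by omega) (by omega)) (not_lt.2 hj.le)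
  · refine List.pairwise_cons.2 ⟨fun y hy => ?_, ?_⟩
    · obtain ⟨j, -, rfl⟩ := (mem_map_blockEnds π y).1 hy
      omega
    · rw [List.pairwise_map]
      refine (Finset.sortedLT_sort _).pairwise.imp fun {a b} h => ?_
      have : (a : ℕ) < b := h
      omega
  · intro y hy
    obtain ⟨j, -, rfl⟩ := (mem_map_blockEnds π y).1 hy
    exact j.2

theorem card_deals_ascending_window {n m s : ℕ} (hs : s + m < 2 * n) :
    ((deals n).filter fun π =>
        ∀ t : Fin (2 * n), s ≤ (t : ℕ) → (t : ℕ) < s + m → t < π t).card =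
      (2 * n - m - s).descFactorial m * pairingCount (2 * n - 2 * m) := by
  set W : Finset (Fin (2 * n)) := Finset.univ.filter fun t => s ≤ (t : ℕ) ∧ (t : ℕ) < s + m with hW
  set R : Finset (Fin (2 * n)) := Finset.Ici ⟨s + m, hs⟩ with hR
  have hWc : W.card = m := by
    have : W = Finset.Ico ⟨s, by omega⟩ ⟨s + m, hs⟩ := by
      ext t
      simp [hW, Fin.le_def, Fin.lt_def]
    rw [this, Fin.card_Ico]
    simp
  have hRc : R.card = 2 * n - m - s := by
    rw [hR, Fin.card_Ici]
    simp only
    omega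
  have key := card_pairings (Finset.subset_univ W) (Finset.subset_univ R) <| by
    rw [Finset.disjoint_left]
    intro t
    simp only [hW, hR, Finset.mem_filter, Finset.mem_Ici, Fin.le_def]
    omega
  rw [hWc, hRc, Finset.card_univ, Fintype.card_fin] at key
  rw [← key]
  congr 1
  ext π
  simp only [deals, IsDeal, pairings, Finset.mem_filter, Finset.mem_univ, true_and, not_true,
    iff_false, forall_and, hW, hR, Finset.mem_Ici, Fin.le_def, and_assoc]
  refine and_congr_right fun h1 => and_congr_right fun _ => ⟨fun h w hw => ?_, fun h t h2 h3 => ?_⟩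
  · by_contra hlt
    have h4 : (w : ℕ) < π w := h w hw.1 hw.2
    have h5 : (π w : ℕ) < π (π w) := h (π w) (by omega) (by omega)
    rw [h1] at h5
    omega
  · have := h t ⟨h2, h3⟩
    rw [Fin.lt_def]
    omega

theorem sum_range_descFactorial_mul (M m : ℕ) :
    (∑ r ∈ Finset.range M, r.descFactorial m) * (m + 1) = M.descFactorial (m + 1) := by
  induction M with
  | zero => simp
  | succ M ih =>
    rw [Finset.sum_range_succ, add_mul, ih, Nat.succ_descFactorial_succ, Nat.descFactorial_succ]
    rcases le_or_gt m M with h | h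
    · rw [mul_comm (M.descFactorial m), ← add_mul]
      congr 1
      omega
    · simp [Nat.descFactorial_of_lt h]

theorem sum_deals_sum_blockLens_sub (n : ℕ) {m : ℕ} (hm : 1 ≤ m) :
    (∑ π ∈ deals n, ((blockLens π).map (· - m)).sum) * (m + 1) =
      (2 * n - m + 1).descFactorial (m + 1) * pairingCount (2 * n - 2 * m) := by
  have h1 : ∑ π ∈ deals n, ((blockLens π).map (· - m)).sum =
      ∑ s ∈ Finset.range (2 * n - m),
        (2 * n - m - s).descFactorial m * pairingCount (2 * n - 2 * m) := by
    have hI : ∀ π ∈ deals n, IsDeal n π := fun π hπ => (Finset.mem_filter.1 hπ).2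
    rw [Finset.sum_congr rfl fun π hπ => sum_blockLens_sub hm (hI π hπ)]
    refine (Finset.sum_card_bipartiteAbove_eq_sum_card_bipartiteBelow
      (fun (π : Fin (2 * n) → Fin (2 * n)) s =>
        ∀ t : Fin (2 * n), s ≤ (t : ℕ) → (t : ℕ) < s + m → t < π t)).trans ?_
    refine Finset.sum_congr rfl fun s hs => ?_
    rw [Finset.mem_range] at hs
    exact card_deals_ascending_window (by omega)
  have h2 : ∑ s ∈ Finset.range (2 * n - m), (2 * n - m - s).descFactorial m =
      ∑ r ∈ Finset.range (2 * n - m + 1), r.descFactorial m := by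
    rw [Finset.sum_range_succ', Nat.descFactorial_of_lt (by omega : 0 < m), add_zero,
      ← Finset.sum_range_reflect]
    refine Finset.sum_congr rfl fun s hs => ?_
    rw [Finset.mem_range] at hs
    congr 1
    omega
  rw [h1, ← Finset.sum_mul, h2, mul_right_comm, sum_range_descFactorial_mul]

theorem pairingCount_pos (n : ℕ) : 0 < pairingCount (2 * n) := by
  induction n with
  | zero => simp [pairingCount]
  | succ n ih =>
    rw [mul_add, mul_one, pairingCount]
    positivity

/-- `m + 1` times the expected number of windows of `m` consecutive first occurrences. -/
noncomputable def windowWeight (n m : ℕ) : ℝ :=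
  ((2 * n - m + 1).descFactorial (m + 1) * pairingCount (2 * n - 2 * m) : ℕ) /
    (pairingCount (2 * n) : ℝ)

theorem windowWeight_nonneg (n m : ℕ) : 0 ≤ windowWeight n m := by
  unfold windowWeight; positivity

theorem windowWeight_zero (n : ℕ) : windowWeight n 0 = 2 * n + 1 := by
  have := (pairingCount_pos n).ne'
  simp [windowWeight]
  field_simp

theorem windowWeight_of_lt {n m : ℕ} (h : n < m) : windowWeight n m = 0 := by
  rw [windowWeight, Nat.descFactorial_of_lt (by omega)]
  simp

theorem windowWeight_succ (n m : ℕ) :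
    (2 * n - m + 1 : ℝ) * windowWeight n (m + 1) = 2 * (n - m) * windowWeight n m := by
  rcases lt_trichotomy n m with h | rfl | h
  · simp [windowWeight_of_lt h, windowWeight_of_lt (h.trans (Nat.lt_succ_self m))]
  · simp [windowWeight_of_lt]
  · obtain ⟨k, rfl⟩ := Nat.exists_eq_add_of_lt h
    rw [windowWeight, windowWeight]
    have e1 : 2 * (m + k + 1) - (m + 1) + 1 = m + 2 * k + 2 := by omega
    have e2 : 2 * (m + k + 1) - 2 * (m + 1) = 2 * k := by omega
    have e3 : 2 * (m + k + 1) - m + 1 = m + 2 * k + 2 + 1 := by omega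
    have e4 : 2 * (m + k + 1) - 2 * m = 2 * k + 2 := by omega
    rw [e1, e2, e3, e4, Nat.succ_descFactorial_succ (m + 2 * k + 2) m, pairingCount,
      Nat.descFactorial_succ (m + 2 * k + 2) (m + 1), Nat.descFactorial_succ (m + 2 * k + 2) m]
    have e5 : m + 2 * k + 2 - (m + 1) = 2 * k + 1 := by omega
    have e6 : m + 2 * k + 2 - m = 2 * k + 2 := by omega
    rw [e5, e6]
    push_cast
    ring

/-- The expected number of windows of `m` consecutive first occurrences, minus the main term
`(2 * n + 1) / (m + 1)`; its second differences are the values of `db`. -/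
noncomputable def windowExcess (n m : ℕ) : ℝ := (windowWeight n m - (2 * n + 1)) / (m + 1)

theorem db_eq (n : ℕ) {j : ℕ} (hj : 1 ≤ j) :
    db n (j + 1) = windowExcess n j - 2 * windowExcess n (j + 1) + windowExcess n (j + 2) := by
  have hw : ∀ m, 1 ≤ m → windowWeight n m =
      (∑ π ∈ deals n, ((blockLens π).map (· - m)).sum : ℕ) * (m + 1) / (deals n).card := by
    intro m hm
    rw [windowWeight, ← sum_deals_sum_blockLens_sub n hm, card_deals]
    push_cast
    rfl
  have hb : bcount n (j + 1) + 2 * ∑ π ∈ deals n, ((blockLens π).map (· - (j + 1))).sum =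
      ∑ π ∈ deals n, ((blockLens π).map (· - j)).sum +
        ∑ π ∈ deals n, ((blockLens π).map (· - (j + 2))).sum := by
    rw [bcount, Finset.mul_sum, ← Finset.sum_add_distrib, ← Finset.sum_add_distrib]
    exact Finset.sum_congr rfl fun π _ => count_eq_sum_sub j _
  rw [db, eb, windowExcess, windowExcess, windowExcess, hw j hj, hw (j + 1) (by omega),
    hw (j + 2) (by omega)]
  have hb' := congrArg (Nat.cast : ℕ → ℝ) hb
  rw [Nat.cast_add, Nat.cast_add, Nat.cast_mul] at hb'
  have hD : ((deals n).card : ℝ) ≠ 0 := by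
    rw [card_deals]
    exact_mod_cast (pairingCount_pos n).ne'
  rw [eq_sub_of_add_eq hb']
  push_cast
  field_simp
  ring

/-- The increment of `db` scaled so that its own increments are fourth differences. -/
noncomputable def scaledIncrement (n i : ℕ) : ℝ :=
  ((i : ℝ) + 1) * (i + 2) * (i + 3) * (i + 4) * (db n (i + 2) - db n (i + 1))

theorem scaledIncrement_nonneg_iff (n i : ℕ) :
    0 ≤ scaledIncrement n i ↔ db n (i + 1) ≤ db n (i + 2) := by
  rw [scaledIncrement, mul_nonneg_iff_of_pos_left (by positivity), sub_nonneg]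

theorem scaledIncrement_eq {n i : ℕ} (hi : 1 ≤ i) :
    scaledIncrement n i = 6 * (2 * n + 1) - (i + 2) * (i + 3) * (i + 4) * windowWeight n i
      + 3 * ((i + 1) * (i + 3) * (i + 4)) * windowWeight n (i + 1)
      - 3 * ((i + 1) * (i + 2) * (i + 4)) * windowWeight n (i + 2)
      + (i + 1) * (i + 2) * (i + 3) * windowWeight n (i + 3) := by
  rw [scaledIncrement, db_eq n hi, db_eq n (Nat.le_add_left 1 i)]
  simp only [windowExcess, add_assoc, Nat.reduceAdd]
  push_cast
  field_simp
  ring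

theorem scaledIncrement_succ_sub {n i : ℕ} (hi : 1 ≤ i) :
    scaledIncrement n (i + 1) - scaledIncrement n i = (i + 2) * (i + 3) * (i + 4) *
      (windowWeight n (i + 4) - 4 * windowWeight n (i + 3) + 6 * windowWeight n (i + 2)
        - 4 * windowWeight n (i + 1) + windowWeight n i) := by
  rw [scaledIncrement_eq hi, scaledIncrement_eq (Nat.le_add_left 1 i)]
  simp only [add_assoc, Nat.reduceAdd]
  push_cast
  ring

theorem windowWeight_pos {n m : ℕ} (h : m ≤ n) : 0 < windowWeight n m := by
  rw [windowWeight, show 2 * n - 2 * m = 2 * (n - m) by omega]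
  have h1 := pairingCount_pos n
  have h2 := pairingCount_pos (n - m)
  have h3 : 0 < (2 * n - m + 1).descFactorial (m + 1) := by
    rw [Nat.pos_iff_ne_zero, Ne, Nat.descFactorial_eq_zero_iff_lt]
    omega
  positivity

/-- The polynomial governing the sign of the fourth difference of `windowWeight n` at `m`. -/
noncomputable def valley (n m : ℕ) : ℝ :=
  12 * (n : ℝ) ^ 2 - 12 * n * (m ^ 2 + 3 * m + 1) + m * (m + 1) * (m + 2) * (m + 7)

theorem exists_fourth_difference_eq {n i : ℕ} (hn : 2 ≤ n) (hi : i + 1 ≤ n) :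
    ∃ c : ℝ, 0 < c ∧
      windowWeight n (i + 4) - 4 * windowWeight n (i + 3) + 6 * windowWeight n (i + 2)
        - 4 * windowWeight n (i + 1) + windowWeight n i = c * valley n i := by
  have hn' : (2 : ℝ) ≤ n := by exact_mod_cast hn
  have hi' : (i : ℝ) + 1 ≤ n := by exact_mod_cast hi
  have h0 := windowWeight_succ n i
  have h1 := windowWeight_succ n (i + 1)
  have h2 := windowWeight_succ n (i + 2)
  have h3 := windowWeight_succ n (i + 3)
  push_cast [add_assoc] at h1 h2 h3
  have a0 : 0 < (2 * n - i + 1 : ℝ) := by linarith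
  have a1 : 0 < (2 * n - (i + 1) + 1 : ℝ) := by linarith
  have a2 : 0 < (2 * n - (i + 2) + 1 : ℝ) := by linarith
  have a3 : 0 < (2 * n - (i + 3) + 1 : ℝ) := by linarith
  refine ⟨windowWeight n i / ((2 * n - i + 1) * (2 * n - (i + 1) + 1) * (2 * n - (i + 2) + 1) *
    (2 * n - (i + 3) + 1)), div_pos (windowWeight_pos (by omega)) (by positivity), ?_⟩
  rw [eq_div_of_mul_eq a3.ne' ((mul_comm _ _).trans h3),
    eq_div_of_mul_eq a2.ne' ((mul_comm _ _).trans h2),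
    eq_div_of_mul_eq a1.ne' ((mul_comm _ _).trans h1),
    eq_div_of_mul_eq a0.ne' ((mul_comm _ _).trans h0), valley]
  field_simp
  ring

theorem valley_succ_sub (n m : ℕ) :
    valley n (m + 1) - valley n m = 4 * (m + 2) * ((m + 1) * (m + 6) - 6 * n) := by
  simp only [valley]
  push_cast
  ring

theorem valley_pos_of_le {n a b c : ℕ} (hab : a ≤ b) (hbc : b ≤ c) (ha : valley n a < 0)
    (hb : 0 < valley n b) : 0 < valley n c := by
  have hinc : 6 * (n : ℝ) ≤ (b + 1) * (b + 6) := by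
    by_contra! hlt
    have : ∀ m, a ≤ m → m ≤ b → valley n m < 0 := by
      intro m hm
      induction m, hm using Nat.le_induction with
      | base => exact fun _ => ha
      | succ m hm ih =>
        intro hmb
        have h1 := ih (by omega)
        have h2 := valley_succ_sub n m
        have h3 : (m : ℝ) ≤ b := by exact_mod_cast (by omega : m ≤ b)
        have h4 : ((m : ℝ) + 1) * (m + 6) ≤ (b + 1) * (b + 6) := by gcongr
        have h5 : 4 * ((m : ℝ) + 2) * ((m + 1) * (m + 6) - 6 * n) ≤ 0 :=
          mul_nonpos_of_nonneg_of_nonpos (by positivity) (by linarith)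
        linarith
    exact absurd (this b hab le_rfl) hb.not_gt
  induction c, hbc using Nat.le_induction with
  | base => exact hb
  | succ c hc ih =>
    have h2 := valley_succ_sub n c
    have h3 : (b : ℝ) ≤ c := by exact_mod_cast hc
    have h4 : ((b : ℝ) + 1) * (b + 6) ≤ (c + 1) * (c + 6) := by gcongr
    have h5 : 0 ≤ 4 * ((c : ℝ) + 2) * ((c + 1) * (c + 6) - 6 * n) :=
      mul_nonneg (by positivity) (by linarith)
    linarith

theorem exists_scaledIncrement_succ_sub_eq {n i : ℕ} (hn : 2 ≤ n) (h1 : 1 ≤ i) (hi : i + 1 ≤ n) :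
    ∃ c : ℝ, 0 < c ∧ scaledIncrement n (i + 1) - scaledIncrement n i = c * valley n i := by
  obtain ⟨c, hc, h⟩ := exists_fourth_difference_eq hn hi
  refine ⟨(i + 2) * (i + 3) * (i + 4) * c, by positivity, ?_⟩
  rw [scaledIncrement_succ_sub h1, h, mul_assoc _ c]

theorem scaledIncrement_pos_of_lt {n i : ℕ} (h : n < i) : 0 < scaledIncrement n i := by
  rw [scaledIncrement_eq (by omega)]
  simp only [windowWeight_of_lt h, windowWeight_of_lt (show n < i + 1 by omega),
    windowWeight_of_lt (show n < i + 2 by omega), windowWeight_of_lt (show n < i + 3 by omega)]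
  ring_nf
  positivity

theorem windowWeight_one {n : ℕ} : windowWeight n 1 = 2 * n := by
  have h := windowWeight_succ n 0
  rw [windowWeight_zero] at h
  have hn : (0 : ℝ) < 2 * n + 1 := by positivity
  refine mul_left_cancel₀ hn.ne' ?_
  simp only [Nat.cast_zero, sub_zero, zero_add] at h
  rw [h]
  ring

theorem windowWeight_two {n : ℕ} (hn : 1 ≤ n) : windowWeight n 2 = 2 * n - 2 := by
  have h := windowWeight_succ n 1
  rw [windowWeight_one] at h
  have hn : (1 : ℝ) ≤ n := by exact_mod_cast hn
  refine mul_left_cancel₀ (show (2 * n : ℝ) ≠ 0 by positivity) ?_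
  norm_num at h
  rw [h]
  ring

theorem scaledIncrement_one_pos {n : ℕ} (hn : 2 ≤ n) : 0 < scaledIncrement n 1 := by
  have h3 := windowWeight_succ n 2
  have h4 := windowWeight_succ n 3
  rw [windowWeight_two (by omega)] at h3
  have hn' : (2 : ℝ) ≤ n := by exact_mod_cast hn
  have a3 : (0 : ℝ) < 2 * n - 1 := by linarith
  have a4 : (0 : ℝ) < 2 * n - 2 := by linarith
  norm_num at h3 h4
  have e3 : windowWeight n 3 = 4 * (n - 2) * (n - 1) / (2 * n - 1) := by
    rw [eq_div_iff a3.ne']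
    linarith
  have e4 : windowWeight n 4 = 4 * (n - 2) * (n - 3) / (2 * n - 1) := by
    rw [e3] at h4
    refine mul_left_cancel₀ a4.ne' ?_
    have : (2 * n - 2 : ℝ) = 2 * n - 3 + 1 := by ring
    rw [this, h4]
    ring
  rw [scaledIncrement_eq le_rfl]
  norm_num
  rw [windowWeight_one, windowWeight_two (by omega), e3, e4]
  have : 0 < 90 / (2 * n - 1 : ℝ) := by positivity
  refine this.trans_eq ?_
  field_simp
  ring

theorem exists_scaledIncrement_neg {n : ℕ} (hn : 1 ≤ n) :
    ∃ i, 1 ≤ i ∧ scaledIncrement n i < 0 := by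
  by_contra! hT
  have h0 : db n (n + 2) ≤ 0 := by
    rw [db_eq n (by omega)]
    simp only [windowExcess, windowWeight_of_lt (show n < n + 1 by omega),
      windowWeight_of_lt (show n < n + 1 + 1 by omega),
      windowWeight_of_lt (show n < n + 1 + 2 by omega)]
    have : 0 ≤ 2 * (2 * (n : ℝ) + 1) / ((n + 2) * (n + 3) * (n + 4)) := by positivity
    refine le_of_eq_of_le ?_ (neg_nonpos.2 this)
    push_cast
    field_simp
    ring
  have hdb : ∀ i, i ≤ n + 1 → 1 ≤ i → db n (i + 1) ≤ 0 := by
    intro i hi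
    induction hi using Nat.decreasingInduction with
    | self => exact fun _ => h0
    | of_succ i hi ih =>
      exact fun h1 => ((scaledIncrement_nonneg_iff n i).1 (hT i h1)).trans (ih (by omega))
  have hdec : ∀ i, 1 ≤ i → i ≤ n + 1 → windowExcess n (i + 1) - windowExcess n i ≤ -1 / 2 := by
    intro i hi
    induction i, hi using Nat.le_induction with
    | base =>
      intro _
      simp only [windowExcess, windowWeight_one, windowWeight_two hn]
      norm_num
      linarith
    | succ i hi ih =>
      intro hin
      have h1 := ih (by omega)
      have h2 := hdb i (by omega) hi
      rw [db_eq n hi] at h2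
      rw [show i + 1 + 1 = i + 2 from rfl]
      linarith
  have hlast := hdec (n + 1) (by omega) le_rfl
  simp only [windowExcess, windowWeight_of_lt (show n < n + 1 by omega),
    windowWeight_of_lt (show n < n + 1 + 1 by omega)] at hlast
  have : 0 ≤ (2 * (n : ℝ) + 1) / ((n + 2) * (n + 3)) := by positivity
  have e : (2 * (n : ℝ) + 1) / ((n + 2) * (n + 3)) =
      (0 - (2 * n + 1)) / (((n + 1 + 1 : ℕ) : ℝ) + 1) -
        (0 - (2 * n + 1)) / (((n + 1 : ℕ) : ℝ) + 1) := by
    push_cast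
    field_simp
    ring
  linarith

theorem scaledIncrement_nonneg_of_le {n k l i : ℕ} (hk : 1 ≤ k) (hkl : k ≤ l) (hli : l ≤ i)
    (hneg : scaledIncrement n (k + 1) < 0) (hk0 : 0 ≤ scaledIncrement n k)
    (hl0 : scaledIncrement n l < 0) (hl1 : 0 ≤ scaledIncrement n (l + 1)) :
    0 ≤ scaledIncrement n (i + 1) := by
  induction i, hli using Nat.le_induction with
  | base => exact hl1
  | succ i hli ih =>
    rcases Nat.lt_or_ge n (i + 1 + 1) with h | h
    · exact (scaledIncrement_pos_of_lt h).le
    have hn : 2 ≤ n := by omega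
    obtain ⟨ck, hck, ek⟩ := exists_scaledIncrement_succ_sub_eq hn hk (by omega)
    obtain ⟨cl, hcl, el⟩ := exists_scaledIncrement_succ_sub_eq hn (hk.trans hkl) (by omega)
    obtain ⟨ci, hci, ei⟩ := exists_scaledIncrement_succ_sub_eq hn (by omega : 1 ≤ i + 1) h
    have vk : valley n k < 0 := neg_of_mul_neg_right (by linarith) hck.le
    have vl : 0 < valley n l := pos_of_mul_pos_right (by linarith) hcl.le
    have vi := mul_pos hci (valley_pos_of_le hkl (by omega : l ≤ i + 1) vk vl)
    linarith

/-- For `n ≥ 1`, there exist `2 ≤ k < ℓ ≤ n+2` such that `j ↦ db(n,j)` is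
nondecreasing on `[2,k]`, nonincreasing on `[k,ℓ]`, and nondecreasing on
`[ℓ,∞)`. -/
theorem db_shape (n : ℕ) (hn : 1 ≤ n) :
    ∃ k ℓ : ℕ, 2 ≤ k ∧ k < ℓ ∧ ℓ ≤ n + 2 ∧
      (∀ j, 2 ≤ j → j < k → db n j ≤ db n (j+1)) ∧
      (∀ j, k ≤ j → j < ℓ → db n (j+1) ≤ db n j) ∧
      (∀ j, ℓ ≤ j → db n j ≤ db n (j+1)) := by
  have hneg := exists_scaledIncrement_neg hn
  set k := Nat.find hneg
  obtain ⟨hk1, hkT⟩ : 1 ≤ k ∧ scaledIncrement n k < 0 := Nat.find_spec hneg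
  have hkmin : ∀ i, 1 ≤ i → i < k → 0 ≤ scaledIncrement n i := fun i h1 h2 => by
    by_contra! h
    exact Nat.find_min hneg h2 ⟨h1, h⟩
  have hkn : k ≤ n := by
    by_contra! h
    exact hkT.not_gt (scaledIncrement_pos_of_lt h)
  have hpos : ∃ i, k ≤ i ∧ 0 ≤ scaledIncrement n i :=
    ⟨n + 1, by omega, (scaledIncrement_pos_of_lt n.lt_succ_self).le⟩
  set l := Nat.find hpos
  obtain ⟨hl1, hlT⟩ : k ≤ l ∧ 0 ≤ scaledIncrement n l := Nat.find_spec hpos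
  have hlmin : ∀ i, k ≤ i → i < l → scaledIncrement n i < 0 := fun i h1 h2 => by
    by_contra! h
    exact Nat.find_min hpos h2 ⟨h1, h⟩
  have hln : l ≤ n + 1 :=
    Nat.find_min' hpos ⟨by omega, (scaledIncrement_pos_of_lt n.lt_succ_self).le⟩
  have hkl : k < l := lt_of_le_of_ne hl1 fun e => hkT.not_ge (e ▸ hlT)
  have hafter : ∀ i, l ≤ i → 0 ≤ scaledIncrement n i := by
    intro i hi
    rcases Nat.lt_or_ge n i with h | h
    · exact (scaledIncrement_pos_of_lt h).le
    have hk2 : k ≠ 1 := fun e =>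
      hkT.not_gt (e ▸ scaledIncrement_one_pos (by omega))
    obtain ⟨k', hk'⟩ : ∃ k', k = k' + 1 := ⟨k - 1, by omega⟩
    obtain ⟨l', hl'⟩ : ∃ l', l = l' + 1 := ⟨l - 1, by omega⟩
    obtain ⟨i', rfl⟩ : ∃ i', i = i' + 1 := ⟨i - 1, by omega⟩
    exact scaledIncrement_nonneg_of_le (k := k') (l := l') (by omega) (by omega) (by omega)
      (hk' ▸ hkT) (hkmin k' (by omega) (by omega)) (hlmin l' (by omega) (by omega)) (hl' ▸ hlT)
  refine ⟨k + 1, l + 1, by omega, by omega, by omega, fun j h2 hj => ?_, fun j hj1 hj2 => ?_,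
    fun j hj => ?_⟩ <;> obtain ⟨i, rfl⟩ : ∃ i, j = i + 1 := ⟨j - 1, by omega⟩
  · exact (scaledIncrement_nonneg_iff n i).1 (hkmin i (by omega) (by omega))
  · have h := hlmin i (by omega) (by omega)
    rw [← not_le, scaledIncrement_nonneg_iff, not_le] at h
    exact h.le
  · exact (scaledIncrement_nonneg_iff n i).1 (hafter i (by omega))
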